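/- Let C ∈ (ℝ²)*⊗(ℝ²)*⊗ℝ². The tensor C is fixed by the natural action of the linear map diag(1,−1) (i.e. the coordinate change (x¹,x²) ↦ (x¹,−x²)) if and only if C₁₁² = C₁₂¹ = C₂₁¹ = C₂₂² = 0. In that case the Ricci matrix ρ_C is diagonal: ρ_C = diag( (C₁₁¹ − C₁₂² + 1)·C₂₁² , (C₁₁¹ − C₁₂² − 1)·C₂₂¹ ), and in particular ρ_C is symmetric. -/

import Mathlib

open scoped BigOperators
open Matrix

/-- The Ricci matrix `ρ_C` of the Type B connection with Christoffel symbols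
`Γ_{ij}{}^k = C_{ij}{}^k/x¹` (evaluated at `x¹ = 1`; indices are 0-based, so
`C 0 0 0 = C₁₁¹`, etc.). -/
noncomputable def rhoC (C : Fin 2 → Fin 2 → Fin 2 → ℝ) : Matrix (Fin 2) (Fin 2) ℝ :=
  !![(C 0 0 0 - C 0 1 1 + 1) * C 1 0 1 + C 0 0 1 * (C 1 1 1 - C 1 0 0),
     C 1 1 1 + C 0 1 0 * C 1 0 1 - C 0 0 1 * C 1 1 0;
     -C 1 0 0 + C 0 1 0 * C 1 0 1 - C 0 0 1 * C 1 1 0,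
     (C 0 0 0 - C 0 1 1 - 1) * C 1 1 0 + C 0 1 0 * (C 1 1 1 - C 1 0 0)]

/-- The symmetric Ricci matrix `ρ_{s,C} = (ρ_C + ρ_Cᵀ)/2`. -/
noncomputable def rhoS (C : Fin 2 → Fin 2 → Fin 2 → ℝ) : Matrix (Fin 2) (Fin 2) ℝ :=
  (1 / 2 : ℝ) • (rhoC C + (rhoC C)ᵀ)
/-- The shear-dilation matrix `M_{a,b}`, i.e. the linear map with
`M e₁ = e₁ + a e₂` and `M e₂ = b e₂` (corresponding to the coordinate change
`(x¹,x²) ↦ (x¹, a x¹ + b x²)`). -/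
noncomputable def Mab (a b : ℝ) : Matrix (Fin 2) (Fin 2) ℝ := !![1, 0; a, b]

/-- The natural tensor action of an invertible matrix `M` on
`C ∈ (ℝ²)* ⊗ (ℝ²)* ⊗ ℝ²`: the two covariant slots transform by `M⁻¹` and the
contravariant slot by `M`. -/
noncomputable def tensorAct (M : Matrix (Fin 2) (Fin 2) ℝ)
    (C : Fin 2 → Fin 2 → Fin 2 → ℝ) : Fin 2 → Fin 2 → Fin 2 → ℝ :=
  fun i j k => ∑ p : Fin 2, ∑ q : Fin 2, ∑ r : Fin 2,
    M⁻¹ p i * M⁻¹ q j * M k r * C p q r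

theorem tensorAct_reflection (C : Fin 2 → Fin 2 → Fin 2 → ℝ) (i j k : Fin 2) :
    tensorAct !![(1 : ℝ), 0; 0, -1] C i j k = (-1) ^ (i.val + j.val + k.val) * C i j k := by
  have hinv : (!![(1 : ℝ), 0; 0, -1])⁻¹ = !![(1 : ℝ), 0; 0, -1] :=
    Matrix.inv_eq_right_inv (by simp [Matrix.one_fin_two])
  rw [tensorAct, hinv]
  fin_cases i <;> fin_cases j <;> fin_cases k <;> norm_num [Fin.sum_univ_two]

theorem rhoC_eq_diagonal {C : Fin 2 → Fin 2 → Fin 2 → ℝ} (h₁ : C 0 0 1 = 0) (h₂ : C 0 1 0 = 0)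
    (h₃ : C 1 0 0 = 0) (h₄ : C 1 1 1 = 0) :
    rhoC C = !![(C 0 0 0 - C 0 1 1 + 1) * C 1 0 1, 0;
                0, (C 0 0 0 - C 0 1 1 - 1) * C 1 1 0] := by
  simp [rhoC, h₁, h₂, h₃, h₄]

/-- A tensor `C ∈ (ℝ²)*⊗(ℝ²)*⊗ℝ²` is fixed by the natural action of `diag(1,−1)`
(the coordinate change `(x¹,x²) ↦ (x¹,−x²)`) if and only if
`C₁₁² = C₁₂¹ = C₂₁¹ = C₂₂² = 0`; in that case the Ricci matrix is diagonal,
`ρ_C = diag((C₁₁¹−C₁₂²+1)C₂₁², (C₁₁¹−C₁₂²−1)C₂₂¹)`, and in particular symmetric. -/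
theorem reflection_fixed_iff (C : Fin 2 → Fin 2 → Fin 2 → ℝ) :
    (tensorAct !![(1 : ℝ), 0; 0, -1] C = C ↔
      (C 0 0 1 = 0 ∧ C 0 1 0 = 0 ∧ C 1 0 0 = 0 ∧ C 1 1 1 = 0)) ∧
    ((C 0 0 1 = 0 ∧ C 0 1 0 = 0 ∧ C 1 0 0 = 0 ∧ C 1 1 1 = 0) →
      rhoC C = !![(C 0 0 0 - C 0 1 1 + 1) * C 1 0 1, 0;
                  0, (C 0 0 0 - C 0 1 1 - 1) * C 1 1 0] ∧
      (rhoC C)ᵀ = rhoC C) := by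
  refine ⟨?_, ?_⟩
  · simp only [funext_iff, tensorAct_reflection, Fin.forall_fin_two]
    norm_num [neg_eq_self, and_assoc]
  · rintro ⟨h₁, h₂, h₃, h₄⟩
    rw [rhoC_eq_diagonal h₁ h₂ h₃ h₄]
    refine ⟨rfl, ?_⟩
    ext i j
    fin_cases i <;> fin_cases j <;> rfl
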